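/- Let T be a regular set of patterns, let π ∈ 𝔖_n(T) have k active sites, and for 1 ≤ j ≤ k let σ_j be the permutation obtained from π by inserting the value n+1 into the L_k(j)-th active site of π. Then for every j with 1 ≤ j < k, the permutations σ_j and σ_{j+1} differ in at most three positions. -/

import Mathlib

/-- The number of positions in which two permutations (as lists) differ. -/
def ddist (σ τ : List ℕ) : ℕ :=
  ((σ.zip τ).filter fun p => p.1 != p.2).length

/-- `π` is a permutation of `{1,…,n}` (written as the list of its values). -/
def IsPermOf (n : ℕ) (π : List ℕ) : Prop := π.Perm (List.range' 1 n)

/-- The lists `s` and `τ` have the same length and are order-isomorphic. -/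
def OrderIsomorphic (s τ : List ℕ) : Prop :=
  s.length = τ.length ∧ ∀ i j : ℕ, i < s.length → j < s.length →
    (s.getD i 0 < s.getD j 0 ↔ τ.getD i 0 < τ.getD j 0)

/-- `π` avoids the pattern `τ`: no subsequence of `π` is order-isomorphic to `τ`. -/
def Avoids (π τ : List ℕ) : Prop := ¬∃ s : List ℕ, s.Sublist π ∧ OrderIsomorphic s τ

/-- `π` avoids every pattern in the set `T`. -/
def AvoidsAll (T : Set (List ℕ)) (π : List ℕ) : Prop := ∀ τ ∈ T, Avoids π τ

/-- Insert the value `n+1` into site `i` of a permutation `π` of `{1,…,n}`; sites are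
numbered from right to left from `1` to `n+1`, so the new value gets exactly `i-1`
entries of `π` to its right. -/
def insertSite (π : List ℕ) (i : ℕ) : List ℕ :=
  π.take (π.length + 1 - i) ++ (π.length + 1) :: π.drop (π.length + 1 - i)

/-- Site `i` of `π` is active with respect to the forbidden patterns `T`: inserting the
next-largest value into site `i` produces a permutation avoiding all patterns of `T`. -/
def ActiveSite (T : Set (List ℕ)) (π : List ℕ) (i : ℕ) : Prop :=
  1 ≤ i ∧ i ≤ π.length + 1 ∧ AvoidsAll T (insertSite π i)

/-- The number of active sites of `π` with respect to `T`. -/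
noncomputable def numActive (T : Set (List ℕ)) (π : List ℕ) : ℕ :=
  {i : ℕ | ActiveSite T π i}.ncard

/-- A set of patterns `T` is regular if every `π ∈ 𝔖_n(T)` (for every `n ≥ 1`) has at
least two active sites, its active sites are right justified, and the number of active
sites of the permutation obtained by inserting `n+1` into the `i`-th active site
depends only on `i` and the number of active sites of `π`, not on `π` itself. -/
def Regular (T : Set (List ℕ)) : Prop :=
  (∀ n : ℕ, 1 ≤ n → ∀ π : List ℕ, IsPermOf n π → AvoidsAll T π →
    2 ≤ numActive T π ∧
      ∀ i j : ℕ, ActiveSite T π i → 1 ≤ j → j ≤ i → ActiveSite T π j) ∧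
  (∀ n m : ℕ, ∀ π ρ : List ℕ, 1 ≤ n → 1 ≤ m → IsPermOf n π → IsPermOf m ρ →
    AvoidsAll T π → AvoidsAll T ρ → numActive T π = numActive T ρ →
    ∀ i : ℕ, 1 ≤ i → i ≤ numActive T π →
      numActive T (insertSite π i) = numActive T (insertSite ρ i))

/-- The unimodal sequence `L_k`: `1,3,5,…,k,(k-1),(k-3),…,4,2` when `k` is odd and
`1,3,5,…,(k-1),k,(k-2),…,4,2` when `k` is even (the odd numbers in `{1,…,k}` in
increasing order followed by the even ones in decreasing order). -/
def Lseq (k : ℕ) : List ℕ :=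
  ((List.range (k + 1)).filter fun x => x % 2 == 1) ++
    (((List.range (k + 1)).filter fun x => x % 2 == 0 && x != 0).reverse)

/-- The list of successors `φ(π^1)` of the upward-directed permutation `π^1` (directions
are recorded as a `Bool`, `true` = up, `false` = down): its `j`-th element is obtained
from `π` by inserting the next-largest value into the `L_k(j)`-th active site (which is
site `L_k(j)`, since active sites are right justified), where `k` is the number of
active sites of `π`; the first successor is directed up and all others down. -/
noncomputable def phiUp (T : Set (List ℕ)) (π : List ℕ) : List (List ℕ × Bool) :=
  match (Lseq (numActive T π)).map (fun i => insertSite π i) with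
  | [] => []
  | a :: rest => (a, true) :: rest.map fun x => (x, false)

/-- The list of successors of a directed permutation: `φ(π^0)` is `φ(π^1)` reversed
with every direction flipped. -/
noncomputable def phi (T : Set (List ℕ)) (p : List ℕ × Bool) : List (List ℕ × Bool) :=
  if p.2 then phiUp T p.1
  else ((phiUp T p.1).map fun q => (q.1, !q.2)).reverse

/-- The list `𝒞_n(T)` of directed permutations: `𝒞_1 = ((1)^1)` and `𝒞_n` is the
concatenation of the lists of successors of the entries of `𝒞_{n-1}`. -/
noncomputable def Cl (T : Set (List ℕ)) : ℕ → List (List ℕ × Bool)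
  | 0 => []
  | 1 => [([1], true)]
  | n + 2 => (Cl T (n + 1)).flatMap (phi T)

theorem filter_odd_range_succ (k : ℕ) :
    ((List.range (k + 1)).filter fun x => x % 2 == 1) =
      (List.range ((k + 1) / 2)).map fun i => 2 * i + 1 := by
  induction k with
  | zero => simp
  | succ k ih =>
    rw [List.range_succ, List.filter_append, ih]
    rcases Nat.even_or_odd' k with ⟨m, rfl | rfl⟩
    · rw [show (2 * m + 1 + 1) / 2 = m + 1 by omega, show (2 * m + 1) / 2 = m by omega,
        List.range_succ]
      simp
    · rw [show (2 * m + 1 + 1 + 1) / 2 = m + 1 by omega,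
        show (2 * m + 1 + 1) / 2 = m + 1 by omega]
      simp
      omega

theorem filter_even_ne_zero_range_succ (k : ℕ) :
    ((List.range (k + 1)).filter fun x => x % 2 == 0 && x != 0) =
      (List.range (k / 2)).map fun i => 2 * i + 2 := by
  induction k with
  | zero => simp
  | succ k ih =>
    rw [List.range_succ, List.filter_append, ih]
    rcases Nat.even_or_odd' k with ⟨m, rfl | rfl⟩
    · rw [show (2 * m + 1) / 2 = m by omega, show 2 * m / 2 = m by omega]
      simp
    · rw [show (2 * m + 1 + 1) / 2 = m + 1 by omega, show (2 * m + 1) / 2 = m by omega,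
        List.range_succ]
      simp
      omega

theorem Lseq_getD (k j : ℕ) (hj : j < k) :
    (Lseq k).getD j 0 = if j < (k + 1) / 2 then 2 * j + 1 else 2 * (k - j) := by
  rw [Lseq, filter_odd_range_succ, filter_even_ne_zero_range_succ]
  split_ifs with h
  · rw [List.getD_append _ _ _ _ (by simpa using h)]
    simp [h]
  · rw [List.getD_append_right _ _ _ _ (by simpa using h), List.getD_eq_getElem _ _ (by simp; omega)]
    simp
    omega

theorem ddist_self (σ : List ℕ) : ddist σ σ = 0 := by
  induction σ with
  | nil => rfl
  | cons a σ ih => simpa [ddist] using ih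

theorem ddist_cons (a b : ℕ) (σ τ : List ℕ) :
    ddist (a :: σ) (b :: τ) = (if a = b then 0 else 1) + ddist σ τ := by
  by_cases h : a = b <;> simp [ddist, h, Nat.add_comm]

theorem ddist_comm (σ τ : List ℕ) : ddist σ τ = ddist τ σ := by
  induction σ generalizing τ with
  | nil => cases τ <;> rfl
  | cons a σ ih =>
    cases τ with
    | nil => rfl
    | cons b τ => simp only [ddist_cons, ih τ, eq_comm]

theorem ddist_append_left (l σ τ : List ℕ) : ddist (l ++ σ) (l ++ τ) = ddist σ τ := by
  induction l with
  | nil => rfl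
  | cons a l ih => simpa [ddist_cons] using ih

theorem ddist_cons_insert_le (x y : ℕ) (r : List ℕ) (d : ℕ) :
    ddist (y :: r) (r.take d ++ x :: r.drop d) ≤ d + 1 := by
  induction d generalizing y r with
  | zero =>
    simp only [List.take_zero, List.drop_zero, List.nil_append, ddist_cons, ddist_self]
    split_ifs <;> omega
  | succ d ih =>
    cases r with
    | nil =>
      simp only [List.take_nil, List.drop_nil, List.nil_append, ddist_cons, ddist_self]
      split_ifs <;> omega
    | cons a r =>
      have h := ih a r
      simp only [List.take_succ_cons, List.drop_succ_cons, List.cons_append, ddist_cons]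
      split_ifs <;> omega

theorem ddist_insert_add_le (x : ℕ) (l : List ℕ) (p d : ℕ) :
    ddist (l.take p ++ x :: l.drop p) (l.take (p + d) ++ x :: l.drop (p + d)) ≤ d + 1 := by
  rw [List.take_add, ← List.drop_drop, List.append_assoc, ddist_append_left]
  exact ddist_cons_insert_le x x _ d

theorem ddist_insertSite_le_of_le (π : List ℕ) {i j d : ℕ} (hij : i ≤ j) (hd : j ≤ i + d) :
    ddist (insertSite π i) (insertSite π j) ≤ d + 1 := by
  obtain ⟨e, he⟩ : ∃ e, π.length + 1 - i = π.length + 1 - j + e :=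
    Nat.exists_eq_add_of_le (by omega)
  rw [ddist_comm, insertSite, insertSite, he]
  exact (ddist_insert_add_le _ π _ e).trans (by omega)

theorem ddist_insertSite_le (π : List ℕ) {i j d : ℕ} (hij : i ≤ j + d) (hji : j ≤ i + d) :
    ddist (insertSite π i) (insertSite π j) ≤ d + 1 := by
  rcases le_total i j with h | h
  · exact ddist_insertSite_le_of_le π h hji
  · rw [ddist_comm]
    exact ddist_insertSite_le_of_le π h hij

/-- Let `T` be a regular set of patterns and `π ∈ 𝔖_n(T)` with `k` active sites, and
for `1 ≤ j ≤ k` let `σ_j` be obtained from `π` by inserting `n+1` into the `L_k(j)`-th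
active site (site `L_k(j)`, active sites being right justified). Then consecutive
successors `σ_j` and `σ_{j+1}` differ in at most three positions. -/
theorem successors_ddist_le_three (T : Set (List ℕ)) (hT : Regular T)
    (n : ℕ) (hn : 1 ≤ n) (π : List ℕ) (hπ : IsPermOf n π) (hav : AvoidsAll T π)
    (k : ℕ) (hk : k = numActive T π) :
    ∀ j : ℕ, 1 ≤ j → j < k →
      ddist (insertSite π ((Lseq k).getD (j - 1) 0))
        (insertSite π ((Lseq k).getD j 0)) ≤ 3 := by
  intro j hj hjk
  rw [Lseq_getD k (j - 1) (by omega), Lseq_getD k j hjk]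
  apply ddist_insertSite_le <;> split_ifs <;> omega
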